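/- arXiv:2305.12934 — 5 statements merged into one kernel-verified Lean document; each statement's English description precedes it below -/
import Mathlib

section
/- Let α₁ > 0, α₂ > 0 and χ ∈ (0,1). Suppose V : ℝ → ℝ is differentiable, V(t) ≥ 0 for all t ≥ 0, and V'(t) ≤ -α₁·V(t) - α₂·V(t)^χ for all t ≥ 0. Then there exists a time T with 0 ≤ T ≤ (1/(α₁(1-χ)))·ln((α₁·V(0)^{1-χ} + α₂)/α₂) such that V(T) = 0. -/
/-- While `V` stays positive, the differential inequality makes the integrating-factor expression
`(α₁ V^(1-χ) + α₂) exp (α₁ (1-χ) t)` nonincreasing. -/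
theorem antitoneOn_rpow_add_mul_exp {α₁ α₂ χ b : ℝ} (hα₁ : 0 ≤ α₁) (hχ₁ : χ ≤ 1) {V : ℝ → ℝ}
    (hV : Differentiable ℝ V) (hVpos : ∀ t ∈ Set.Icc 0 b, 0 < V t)
    (hVderiv : ∀ t ∈ Set.Icc 0 b, deriv V t ≤ -α₁ * V t - α₂ * (V t) ^ χ) :
    AntitoneOn (fun t => (α₁ * (V t) ^ (1 - χ) + α₂) * Real.exp (α₁ * (1 - χ) * t))
      (Set.Icc 0 b) := by
  have hderiv : ∀ t ∈ Set.Icc 0 b,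
      HasDerivAt (fun t => (α₁ * (V t) ^ (1 - χ) + α₂) * Real.exp (α₁ * (1 - χ) * t))
        ((α₁ * (deriv V t * (1 - χ) * (V t) ^ (1 - χ - 1))) * Real.exp (α₁ * (1 - χ) * t) +
          (α₁ * (V t) ^ (1 - χ) + α₂) *
            (Real.exp (α₁ * (1 - χ) * t) * (α₁ * (1 - χ) * 1))) t := fun t ht =>
    ((((hV t).hasDerivAt.rpow_const (Or.inl (hVpos t ht).ne')).const_mul α₁).add_const α₂).mul
      ((hasDerivAt_id t).const_mul (α₁ * (1 - χ))).exp
  refine antitoneOn_of_deriv_nonpos (convex_Icc 0 b)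
    (fun t ht => (hderiv t ht).continuousAt.continuousWithinAt)
    (fun t ht => (hderiv t (interior_subset ht)).differentiableAt.differentiableWithinAt)
    fun t ht => ?_
  replace ht := interior_subset ht
  rw [(hderiv t ht).deriv]
  have hpos := hVpos t ht
  have hmul : V t * (V t) ^ (1 - χ - 1) = (V t) ^ (1 - χ) := by
    rw [Real.rpow_sub_one hpos.ne', mul_div_cancel₀ _ hpos.ne']
  have hinv : (V t) ^ χ * (V t) ^ (1 - χ - 1) = 1 := by
    rw [← Real.rpow_add hpos, show χ + (1 - χ - 1) = 0 by ring, Real.rpow_zero]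
  have hle : deriv V t * (V t) ^ (1 - χ - 1) + α₁ * (V t) ^ (1 - χ) + α₂ ≤ 0 := by
    have := mul_le_mul_of_nonneg_right (hVderiv t ht) (Real.rpow_nonneg hpos.le (1 - χ - 1))
    linear_combination this - α₁ * hmul - α₂ * hinv
  have hcoef : 0 ≤ α₁ * (1 - χ) * Real.exp (α₁ * (1 - χ) * t) :=
    mul_nonneg (mul_nonneg hα₁ (sub_nonneg.2 hχ₁)) (Real.exp_pos _).le
  linear_combination mul_nonpos_of_nonneg_of_nonpos hcoef hle

/-- Finite-time Lyapunov lemma: if `V ≥ 0` is differentiable and satisfies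
`V' ≤ -α₁ V - α₂ V^χ` on `[0, ∞)` with `α₁, α₂ > 0` and `χ ∈ (0,1)`, then `V`
reaches zero no later than `(1/(α₁(1-χ))) * log((α₁ V(0)^(1-χ) + α₂)/α₂)`. -/
theorem finite_time_lyapunov (α₁ α₂ χ : ℝ) (hα₁ : 0 < α₁) (hα₂ : 0 < α₂)
    (hχ₀ : 0 < χ) (hχ₁ : χ < 1) (V : ℝ → ℝ) (hV : Differentiable ℝ V)
    (hVnonneg : ∀ t, 0 ≤ t → 0 ≤ V t)
    (hVderiv : ∀ t, 0 ≤ t → deriv V t ≤ -α₁ * V t - α₂ * (V t) ^ χ) :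
    ∃ T : ℝ, 0 ≤ T ∧
      T ≤ (1 / (α₁ * (1 - χ))) * Real.log ((α₁ * (V 0) ^ (1 - χ) + α₂) / α₂) ∧
      V T = 0 := by
  have hW₀ : 0 < α₁ * (V 0) ^ (1 - χ) + α₂ := by
    have := Real.rpow_nonneg (hVnonneg 0 le_rfl) (1 - χ)
    positivity
  have hχ : 0 < 1 - χ := sub_pos.2 hχ₁
  set b := (1 / (α₁ * (1 - χ))) * Real.log ((α₁ * (V 0) ^ (1 - χ) + α₂) / α₂) with hb
  have hb₀ : 0 ≤ b := by
    refine mul_nonneg (by positivity) (Real.log_nonneg ((one_le_div hα₂).2 ?_))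
    have := mul_nonneg hα₁.le (Real.rpow_nonneg (hVnonneg 0 le_rfl) (1 - χ))
    linarith
  by_contra! hne
  have hVpos : ∀ t ∈ Set.Icc 0 b, 0 < V t := fun t ht =>
    (hVnonneg t ht.1).lt_of_ne' (hne t ht.1 ht.2)
  have hanti := antitoneOn_rpow_add_mul_exp hα₁.le hχ₁.le hV hVpos
    (fun t ht => hVderiv t ht.1) (Set.left_mem_Icc.2 hb₀) (Set.right_mem_Icc.2 hb₀) hb₀
  have hexp : Real.exp (α₁ * (1 - χ) * b) = (α₁ * (V 0) ^ (1 - χ) + α₂) / α₂ := by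
    rw [hb, ← mul_assoc, mul_one_div_cancel (by positivity), one_mul,
      Real.exp_log (div_pos hW₀ hα₂)]
  simp only [hexp, mul_zero, Real.exp_zero, mul_one] at hanti
  rw [mul_div_assoc', div_le_iff₀ hα₂, mul_comm, mul_le_mul_iff_right₀ hW₀] at hanti
  have := mul_pos hα₁ (Real.rpow_pos_of_pos (hVpos b (Set.right_mem_Icc.2 hb₀)) (1 - χ))
  linarith
end

section
/- Let α₁ > 0 and α₂ > 0. Suppose V : ℝ → ℝ is differentiable, V(t) ≥ 0 for all t ≥ 0, and V'(t) ≤ -α₁·V(t) - α₂·√(V(t)) for all t ≥ 0. Then there exists a time T with 0 ≤ T ≤ (2/α₁)·ln(1 + (α₁/α₂)·√(V(0))) such that V(T) = 0. -/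
/-- While `V` stays positive, `V' ≤ -a V - b √V` makes `exp (a t / 2) * (√(V t) + b / a)`
nonincreasing. -/
lemma antitoneOn_exp_mul_sqrt_add {a b T : ℝ} (ha : 0 < a) {V : ℝ → ℝ}
    (hV : Differentiable ℝ V) (hpos : ∀ t ∈ Set.Icc 0 T, 0 < V t)
    (hderiv : ∀ t ∈ Set.Icc 0 T, deriv V t ≤ -a * V t - b * Real.sqrt (V t)) :
    AntitoneOn (fun t => Real.exp (a / 2 * t) * (Real.sqrt (V t) + b / a)) (Set.Icc 0 T) := by
  have hd : ∀ t ∈ Set.Icc 0 T,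
      HasDerivAt (fun t => Real.exp (a / 2 * t) * (Real.sqrt (V t) + b / a))
        (Real.exp (a / 2 * t) * (a / 2 * 1) * (Real.sqrt (V t) + b / a) +
          Real.exp (a / 2 * t) * (deriv V t / (2 * Real.sqrt (V t)))) t := fun t ht =>
    (((hasDerivAt_id t).const_mul (a / 2)).exp).mul
      (((hV t).hasDerivAt.sqrt (hpos t ht).ne').add_const (b / a))
  refine antitoneOn_of_deriv_nonpos (convex_Icc 0 T)
    (fun t ht => (hd t ht).continuousAt.continuousWithinAt)
    (fun t ht => (hd t (interior_subset ht)).differentiableAt.differentiableWithinAt)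
    fun t ht => ?_
  have ht := interior_subset ht
  rw [(hd t ht).deriv]
  have hs : 0 < Real.sqrt (V t) := Real.sqrt_pos.2 (hpos t ht)
  have hsq : Real.sqrt (V t) * Real.sqrt (V t) = V t := Real.mul_self_sqrt (hpos t ht).le
  have hquot : deriv V t / (2 * Real.sqrt (V t)) ≤ -(a / 2) * Real.sqrt (V t) - b / 2 := by
    rw [div_le_iff₀ (by positivity)]
    linear_combination hderiv t ht + a * hsq
  have hab : a / 2 * (b / a) = b / 2 := by field_simp
  have hsum : a / 2 * (Real.sqrt (V t) + b / a) + deriv V t / (2 * Real.sqrt (V t)) ≤ 0 := by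
    linarith
  linear_combination mul_nonpos_of_nonneg_of_nonpos (Real.exp_pos (a / 2 * t)).le hsum

/-- The `χ = 1/2` case of the finite-time Lyapunov lemma: if `V ≥ 0` is differentiable
and satisfies `V' ≤ -α₁ V - α₂ √V` on `[0, ∞)` with `α₁, α₂ > 0`, then `V` reaches zero
no later than `(2/α₁) * log(1 + (α₁/α₂) √(V 0))`. -/
theorem finite_time_lyapunov_sqrt (α₁ α₂ : ℝ) (hα₁ : 0 < α₁) (hα₂ : 0 < α₂)
    (V : ℝ → ℝ) (hV : Differentiable ℝ V)
    (hVnonneg : ∀ t, 0 ≤ t → 0 ≤ V t)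
    (hVderiv : ∀ t, 0 ≤ t → deriv V t ≤ -α₁ * V t - α₂ * Real.sqrt (V t)) :
    ∃ T : ℝ, 0 ≤ T ∧
      T ≤ (2 / α₁) * Real.log (1 + (α₁ / α₂) * Real.sqrt (V 0)) ∧
      V T = 0 := by
  set s := Real.sqrt (V 0)
  have hs : 0 ≤ s := Real.sqrt_nonneg _
  have harg : 0 ≤ α₁ / α₂ * s := by positivity
  set T := (2 / α₁) * Real.log (1 + (α₁ / α₂) * s) with hT
  have hT0 : 0 ≤ T := mul_nonneg (by positivity) (Real.log_nonneg (by linarith))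
  by_contra! hne
  have hpos : ∀ t ∈ Set.Icc 0 T, 0 < V t := fun t ht =>
    (hVnonneg t ht.1).lt_of_ne' (hne t ht.1 ht.2)
  have hanti := antitoneOn_exp_mul_sqrt_add hα₁ hV hpos (fun t ht => hVderiv t ht.1)
    (Set.left_mem_Icc.2 hT0) (Set.right_mem_Icc.2 hT0) hT0
  have hexp : Real.exp (α₁ / 2 * T) = 1 + α₁ / α₂ * s := by
    rw [hT, ← mul_assoc, div_mul_div_cancel₀ two_ne_zero, div_self hα₁.ne', one_mul,
      Real.exp_log (by linarith)]
  have hinv : (1 + α₁ / α₂ * s) * (α₂ / α₁) = s + α₂ / α₁ := by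
    field_simp
    ring
  simp only [hexp, mul_zero, Real.exp_zero, one_mul] at hanti
  have hVT : 0 < Real.sqrt (V T) := Real.sqrt_pos.2 (hpos T (Set.right_mem_Icc.2 hT0))
  have hprod : 0 < (1 + α₁ / α₂ * s) * Real.sqrt (V T) := by positivity
  rw [mul_add, hinv] at hanti
  linarith
end

section
/- Let n, v, p be positive natural numbers; let A be a real n×n matrix, B ∈ ℝⁿ, C a real p×n matrix, N a real v×v matrix, L a real v×p matrix, H ∈ ℝᵛ, and T a real v×n matrix. Assume T·A - N·T - L·C = 0 and H = T·B. Let u : ℝ → ℝ, and let x : ℝ → ℝⁿ and η̂ : ℝ → ℝᵛ be differentiable with x'(t) = A·x(t) + B·u(t) and η̂'(t) = N·η̂(t) + L·(C·x(t)) + H·u(t). Then the error e(t) = T·x(t) - η̂(t) is differentiable and satisfies e'(t) = N·e(t) for all t. -/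
open Matrix

/-- Left multiplication by a constant matrix commutes with differentiation. -/
theorem HasDerivAt.const_mulVec {m n : Type*} [Fintype m] [Fintype n] (M : Matrix m n ℝ)
    {f : ℝ → n → ℝ} {f' : n → ℝ} {t : ℝ} (hf : HasDerivAt f f' t) :
    HasDerivAt (fun s => M *ᵥ f s) (M *ᵥ f') t :=
  (M.mulVecLin.toContinuousLinearMap.hasFDerivAt (x := f t)).comp_hasDerivAt t hf

/-- Observer error dynamics: under the functional observer design conditions
`TA - NT - LC = 0` and `H = TB`, the estimation error `e = Tx - ηhat` satisfies the
autonomous linear dynamics `e' = N e`. -/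
theorem functional_observer_error_dynamics (n v p : ℕ) (hn : 0 < n) (hv : 0 < v) (hp : 0 < p)
    (A : Matrix (Fin n) (Fin n) ℝ) (B : Fin n → ℝ) (C : Matrix (Fin p) (Fin n) ℝ)
    (N : Matrix (Fin v) (Fin v) ℝ) (L : Matrix (Fin v) (Fin p) ℝ) (H : Fin v → ℝ)
    (T : Matrix (Fin v) (Fin n) ℝ)
    (hT : T * A - N * T - L * C = 0) (hH : H = T.mulVec B)
    (u : ℝ → ℝ) (x : ℝ → (Fin n → ℝ)) (ηhat : ℝ → (Fin v → ℝ))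
    (hx : Differentiable ℝ x) (hη : Differentiable ℝ ηhat)
    (hxdyn : ∀ t, deriv x t = A.mulVec (x t) + u t • B)
    (hηdyn : ∀ t, deriv ηhat t = N.mulVec (ηhat t) + L.mulVec (C.mulVec (x t)) + u t • H) :
    Differentiable ℝ (fun t => T.mulVec (x t) - ηhat t) ∧
      ∀ t, deriv (fun t => T.mulVec (x t) - ηhat t) t
        = N.mulVec (T.mulVec (x t) - ηhat t) := by
  have hderiv : ∀ t, HasDerivAt (fun t => T *ᵥ x t - ηhat t) (N *ᵥ (T *ᵥ x t - ηhat t)) t := by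
    intro t
    have hTA : T * A = N * T + L * C := by
      rwa [sub_sub, sub_eq_zero] at hT
    have hvalue : T *ᵥ deriv x t - deriv ηhat t = N *ᵥ (T *ᵥ x t - ηhat t) := by
      rw [hxdyn, hηdyn, hH, mulVec_add, mulVec_mulVec, hTA, add_mulVec, mulVec_smul, mulVec_sub,
        mulVec_mulVec, mulVec_mulVec]
      abel
    rw [← hvalue]
    exact ((hx t).hasDerivAt.const_mulVec T).sub (hη t).hasDerivAt
  exact ⟨fun t => (hderiv t).differentiableAt, fun t => (hderiv t).deriv⟩
end

section
/- Let n, v be positive natural numbers, A a real n×n matrix and N a real v×v matrix such that the spectra of A and N, viewed as complex matrices, are disjoint. Then for every real v×n matrix M, there exists a unique real v×n matrix T satisfying T·A - N·T = M. -/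
open Matrix

namespace Matrix

open Polynomial

variable {m n K : Type*} [Fintype m] [DecidableEq m] [Fintype n] [DecidableEq n] [Field K]

/-- A matrix intertwining `A` and `N` also intertwines `p(A)` and `p(N)`. -/
theorem mul_aeval_eq_aeval_mul {A : Matrix n n K} {N : Matrix m m K} {T : Matrix m n K}
    (h : T * A = N * T) (p : K[X]) : T * aeval A p = aeval N p * T := by
  induction p using Polynomial.induction_on with
  | C a => simp [Algebra.algebraMap_eq_smul_one]
  | add p q hp hq => simp [Matrix.mul_add, Matrix.add_mul, hp, hq]
  | monomial k a ih =>
    rw [pow_succ, ← mul_assoc, map_mul _ _ X, map_mul _ _ X, aeval_X, aeval_X, ← Matrix.mul_assoc,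
      ih, Matrix.mul_assoc, h, Matrix.mul_assoc]

/-- Only the zero matrix intertwines two matrices with coprime characteristic polynomials. -/
theorem eq_zero_of_mul_eq_mul_of_isCoprime_charpoly {A : Matrix n n K} {N : Matrix m m K}
    (hc : IsCoprime A.charpoly N.charpoly) {T : Matrix m n K} (h : T * A = N * T) : T = 0 := by
  obtain ⟨a, b, hab⟩ := hc
  calc
    T = T * aeval A (a * A.charpoly + b * N.charpoly) := by simp [hab]
    _ = T * aeval A (b * N.charpoly) := by simp [aeval_self_charpoly]
    _ = aeval N (b * N.charpoly) * T := mul_aeval_eq_aeval_mul h _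
    _ = 0 := by simp [aeval_self_charpoly]

/-- The Sylvester equation is uniquely solvable when the characteristic polynomials are coprime. -/
theorem existsUnique_mul_sub_mul_eq_of_isCoprime_charpoly {A : Matrix n n K} {N : Matrix m m K}
    (hc : IsCoprime A.charpoly N.charpoly) (M : Matrix m n K) :
    ∃! T : Matrix m n K, T * A - N * T = M := by
  let S : Matrix m n K →ₗ[K] Matrix m n K := mulRightLinearMap m K A - mulLeftLinearMap n K N
  have hinj : Function.Injective S := (injective_iff_map_eq_zero S).2 fun T hT =>
    eq_zero_of_mul_eq_mul_of_isCoprime_charpoly hc (sub_eq_zero.1 hT)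
  exact Function.Bijective.existsUnique ⟨hinj, LinearMap.injective_iff_surjective.1 hinj⟩ M

/-- Matrices whose spectra over an algebraically closed extension are disjoint have coprime
characteristic polynomials. -/
theorem isCoprime_charpoly_of_disjoint_spectrum_map {L : Type*} [Field L] [IsAlgClosed L]
    (f : K →+* L) {A : Matrix n n K} {N : Matrix m m K}
    (h : Disjoint (spectrum L (A.map f)) (spectrum L (N.map f))) :
    IsCoprime A.charpoly N.charpoly := by
  rw [← isCoprime_map f, ← charpoly_map, ← charpoly_map,
    isCoprime_iff_aeval_ne_zero_of_isAlgClosed L L]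
  intro x
  by_contra! hx
  exact Set.disjoint_left.1 h (mem_spectrum_iff_isRoot_charpoly.2 (by simpa using hx.1))
    (mem_spectrum_iff_isRoot_charpoly.2 (by simpa using hx.2))

end Matrix

/-- Sylvester equation solvability: if the spectra of `A` and `N` (viewed as complex
matrices) are disjoint, then for every `M` the equation `TA - NT = M` has a unique
solution `T`. -/
theorem sylvester_equation_unique_solution (n v : ℕ) (hn : 0 < n) (hv : 0 < v)
    (A : Matrix (Fin n) (Fin n) ℝ) (N : Matrix (Fin v) (Fin v) ℝ)
    (hspec : Disjoint (spectrum ℂ (A.map (Complex.ofReal)))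
      (spectrum ℂ (N.map (Complex.ofReal)))) :
    ∀ M : Matrix (Fin v) (Fin n) ℝ,
      ∃! T : Matrix (Fin v) (Fin n) ℝ, T * A - N * T = M :=
  existsUnique_mul_sub_mul_eq_of_isCoprime_charpoly
    (isCoprime_charpoly_of_disjoint_spectrum_map Complex.ofRealHom hspec)
end

section
/- Let m be a positive natural number, A_C a real m×m matrix such that every eigenvalue of A_C, viewed as a complex matrix, has strictly negative real part, and b ∈ ℝᵐ. Then there exists a constant c > 0 such that for every M ≥ 0, every measurable function u : ℝ → ℝ with |u(t)| ≤ M for all t ≥ 0, and every differentiable z : ℝ → ℝᵐ satisfying z'(t) = A_C·z(t) + u(t)·b for all t ≥ 0, one has limsup_{t→∞} ‖z(t)‖ ≤ c·M·‖b‖. -/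
open Matrix Filter

/-- A solution of `z' = a z + g` with `Re a < 0` and `‖g‖ ≤ K` eventually is ultimately bounded
by any number larger than `K / (-Re a)`. -/
lemma eventually_norm_le_of_hasDerivAt_smul_add {E : Type*} [NormedAddCommGroup E]
    [NormedSpace ℂ E] {a : ℂ} (ha : a.re < 0) {z g : ℝ → E} {K : ℝ}
    (hz : ∀ᶠ t in atTop, HasDerivAt z (a • z t + g t) t) (hg : ∀ᶠ t in atTop, ‖g t‖ ≤ K)
    {R : ℝ} (hR : K / (-a.re) < R) : ∀ᶠ t in atTop, ‖z t‖ ≤ R := by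
  obtain ⟨t₀, ht₀⟩ := eventually_atTop.1 (hz.and hg)
  set r := -a.re with hr
  have hr0 : 0 < r := by linarith
  have norm_exp (t : ℝ) : ‖Complex.exp (-a * t)‖ = Real.exp (r * t) := by
    rw [Complex.norm_exp]; simp [hr]
  have hexp (t : ℝ) : HasDerivAt (fun s : ℝ => Complex.exp (-a * s))
      (Complex.exp (-a * t) * -a) t := by
    have h : HasDerivAt (fun s : ℝ => -a * (s : ℂ)) (-a) t := by
      simpa using (Complex.ofRealCLM.hasDerivAt (x := t)).const_mul (-a)
    exact h.cexp
  have hy (t : ℝ) (ht : t₀ ≤ t) : HasDerivAt (fun s : ℝ => Complex.exp (-a * s) • z s)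
      (Complex.exp (-a * t) • g t) t := by
    refine ((hexp t).smul (ht₀ t ht).1).congr_deriv ?_
    module
  set L := ‖Complex.exp (-a * t₀) • z t₀‖ - K / r * Real.exp (r * t₀) with hL
  have hB (t : ℝ) : HasDerivAt (fun s : ℝ => L + K / r * Real.exp (r * s))
      (K * Real.exp (r * t)) t := by
    have h : HasDerivAt (fun s : ℝ => r * s) r t := by
      simpa using (hasDerivAt_id t).const_mul r
    refine ((h.exp.const_mul (K / r)).const_add L).congr_deriv ?_
    field_simp
  have bound (t : ℝ) (ht : t₀ ≤ t) :
      ‖Complex.exp (-a * t) • z t‖ ≤ L + K / r * Real.exp (r * t) := by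
    refine image_norm_le_of_norm_deriv_right_le_deriv_boundary (a := t₀) (b := t)
      (f := fun s : ℝ => Complex.exp (-a * s) • z s)
      (fun s hs => (hy s hs.1).continuousAt.continuousWithinAt)
      (fun s hs => (hy s hs.1).hasDerivWithinAt) (by simp [hL]) hB (fun s hs => ?_)
      (Set.right_mem_Icc.2 ht)
    rw [norm_smul, norm_exp, mul_comm]
    gcongr
    exact (ht₀ s hs.1).2
  have lim : Tendsto (fun t : ℝ => L * Real.exp (-(r * t)) + K / r) atTop (nhds (K / r)) := by
    have h : Tendsto (fun t : ℝ => Real.exp (-(r * t))) atTop (nhds 0) :=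
      Real.tendsto_exp_neg_atTop_nhds_zero.comp (tendsto_id.const_mul_atTop hr0)
    simpa using (h.const_mul L).add_const (K / r)
  filter_upwards [lim.eventually (gt_mem_nhds hR), eventually_ge_atTop t₀] with t ht ht'
  have h := bound t ht'
  rw [norm_smul, norm_exp] at h
  refine le_trans ?_ ht.le
  rw [Real.exp_neg]
  have hpos := Real.exp_pos (r * t)
  refine le_of_mul_le_mul_left (h.trans_eq ?_) hpos
  field_simp

/-- If `∏ (T - aᵢ)` annihilates a solution of `z' = T z + u b` and all `Re aᵢ < 0`, then the
solution is ultimately bounded proportionally to the bound of the input. -/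
lemma exists_eventually_norm_le_of_aeval_prod_eq_zero {E : Type*} [NormedAddCommGroup E]
    [NormedSpace ℂ E] (T : E →L[ℂ] E) (s : Multiset ℂ) (hs : ∀ a ∈ s, a.re < 0) :
    ∃ C : ℝ, 0 ≤ C ∧ ∀ (b : E) (M : ℝ) (u : ℝ → ℝ) (z : ℝ → E),
      (∀ᶠ t in atTop, |u t| ≤ M) →
      (∀ᶠ t in atTop, HasDerivAt z (T (z t) + u t • b) t) →
      (∀ t, Polynomial.aeval T (s.map fun a => Polynomial.X - Polynomial.C a).prod (z t) = 0) →
      ∀ R, C * M * ‖b‖ < R → ∀ᶠ t in atTop, ‖z t‖ ≤ R := by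
  induction s using Multiset.induction_on with
  | empty =>
    refine ⟨0, le_rfl, fun b M u z _ _ h R hR => Eventually.of_forall fun t => ?_⟩
    have : z t = 0 := by simpa using h t
    rw [this, norm_zero]
    linarith
  | cons a s ih =>
    obtain ⟨C, hC, ih⟩ := ih fun x hx => hs x (Multiset.mem_cons_of_mem hx)
    have ha : a.re < 0 := hs a (Multiset.mem_cons_self a s)
    set S : E →L[ℂ] E := T - algebraMap ℂ (E →L[ℂ] E) a with hS
    have hSx (x : E) : S x = T x - a • x := by simp [hS, Algebra.algebraMap_eq_smul_one]
    refine ⟨(C * ‖S‖ + 1) / (-a.re), div_nonneg (by positivity) (by linarith), ?_⟩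
    intro b M u z hu hz h R hR
    have hM : 0 ≤ M := by
      obtain ⟨t, ht⟩ := hu.exists
      exact (abs_nonneg _).trans ht
    have hr : 0 < -a.re := by linarith
    have hR' : (C * ‖S‖ + 1) * M * ‖b‖ < R * (-a.re) := by
      have := mul_lt_mul_of_pos_right hR hr
      refine lt_of_eq_of_lt ?_ this
      have hr' : a.re ≠ 0 := ha.ne
      field_simp
    obtain ⟨K, hK₁, hK₂⟩ := exists_between hR'
    have hw : ∀ᶠ t in atTop, ‖S (z t)‖ ≤ K - M * ‖b‖ := by
      refine ih (S b) M u (fun t => S (z t)) hu ?_ (fun t => ?_) _ ?_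
      · filter_upwards [hz] with t ht
        refine ((S.restrictScalars ℝ).hasFDerivAt.comp_hasDerivAt t ht).congr_deriv ?_
        simp only [ContinuousLinearMap.coe_restrictScalars', map_add, hSx, map_sub, map_smul]
      · have h' := h t
        rw [Multiset.map_cons, Multiset.prod_cons, mul_comm, map_mul] at h'
        simpa [hS] using h'
      · have : C * M * ‖S b‖ ≤ C * M * (‖S‖ * ‖b‖) := by
          gcongr
          exact S.le_opNorm b
        linarith
    refine eventually_norm_le_of_hasDerivAt_smul_add (g := fun t => S (z t) + u t • b) (K := K) ha
      ?_ ?_ ((div_lt_iff₀ hr).2 hK₂)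
    · filter_upwards [hz] with t ht
      convert ht using 1
      rw [hSx]
      abel
    · filter_upwards [hw, hu] with t hwt hut
      have : ‖u t • b‖ ≤ M * ‖b‖ := by
        rw [norm_smul, Real.norm_eq_abs]
        gcongr
      linarith [norm_add_le (S (z t)) (u t • b)]

/-- The inclusion of `ℝⁿ` in `ℂⁿ` as a real-linear isometry. -/
noncomputable def euclideanOfReal (n : Type*) [Fintype n] :
    EuclideanSpace ℝ n →ₗᵢ[ℝ] EuclideanSpace ℂ n where
  toFun x := WithLp.toLp 2 fun i => (x i : ℂ)
  map_add' x y := by ext; simp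
  map_smul' r x := by ext; simp
  norm_map' x := by simp [EuclideanSpace.norm_eq]

/-- Uniform ultimate boundedness of the composite system: if `A_C` is Hurwitz, then
there is `c > 0` such that every solution of `z' = A_C z + u(t) b` with `|u| ≤ M` on
`[0, ∞)` satisfies `limsup_{t→∞} ‖z(t)‖ ≤ c M ‖b‖`. -/
theorem hurwitz_uniform_ultimate_boundedness (m : ℕ) (hm : 0 < m)
    (A_C : Matrix (Fin m) (Fin m) ℝ)
    (hA : ∀ μ ∈ spectrum ℂ (A_C.map (Complex.ofReal)), μ.re < 0)
    (b : EuclideanSpace ℝ (Fin m)) :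
    ∃ c : ℝ, 0 < c ∧
      ∀ M : ℝ, 0 ≤ M → ∀ u : ℝ → ℝ, Measurable u → (∀ t, 0 ≤ t → |u t| ≤ M) →
        ∀ z : ℝ → EuclideanSpace ℝ (Fin m), Differentiable ℝ z →
          (∀ t, 0 ≤ t → deriv z t = (WithLp.equiv 2 (Fin m → ℝ)).symm (A_C.mulVec (z t)) + u t • b) →
          limsup (fun t => ‖z t‖) atTop ≤ c * M * ‖b‖ := by
  set B : Matrix (Fin m) (Fin m) ℂ := A_C.map Complex.ofReal with hB
  set T := Matrix.toEuclideanCLM (𝕜 := ℂ) B with hT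
  set J := euclideanOfReal (Fin m) with hJ
  obtain ⟨C, hC, key⟩ := exists_eventually_norm_le_of_aeval_prod_eq_zero T B.charpoly.roots
    fun a ha => hA a (Matrix.mem_spectrum_of_isRoot_charpoly (Polynomial.isRoot_of_mem_roots ha))
  have hT0 : Polynomial.aeval T
      (B.charpoly.roots.map fun a => Polynomial.X - Polynomial.C a).prod = 0 := by
    rw [← (IsAlgClosed.splits B.charpoly).eq_prod_roots_of_monic B.charpoly_monic, hT,
      Polynomial.aeval_algHom_apply (Matrix.toEuclideanCLM (n := Fin m) (𝕜 := ℂ)),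
      Matrix.aeval_self_charpoly, map_zero]
  have hJT (x : EuclideanSpace ℝ (Fin m)) :
      J ((WithLp.equiv 2 (Fin m → ℝ)).symm (A_C.mulVec x)) = T (J x) := by
    ext i
    simp [hJ, euclideanOfReal, hT, hB, Matrix.mulVec, dotProduct]
  refine ⟨C + 1, by linarith, fun M hM u _ hu z hz hode => le_of_forall_gt_imp_ge_of_dense
    fun R hR => limsup_le_of_le ?_ ?_⟩
  · exact (isBoundedUnder_of ⟨0, fun t => norm_nonneg (z t)⟩ :
      IsBoundedUnder (· ≥ ·) atTop fun t => ‖z t‖).isCoboundedUnder_le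
  have := key (J b) M u (fun t => J (z t)) (eventually_atTop.2 ⟨0, hu⟩) ?_
    (fun t => by rw [hT0]; rfl) R ?_
  · simpa using this
  · filter_upwards [eventually_ge_atTop 0] with t ht
    have h := (hz t).hasDerivAt
    rw [hode t ht] at h
    refine (J.toContinuousLinearMap.hasFDerivAt.comp_hasDerivAt t h).congr_deriv ?_
    rw [← hJT, ← map_smul, ← map_add]
    rfl
  · rw [J.norm_map]
    have : 0 ≤ M * ‖b‖ := by positivity
    linarith
end
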